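/- Let T, S ∈ B(H) and θ ∈ [0, 2π). Then the Schwarz-type inequality |D^θ_ω(T, S)| ≤ ω(T) ω(S) holds, where D^θ_ω(T, S) = lim_{r→0⁺} (ω(T + r e^{iθ} S)² − ω(T)²)/(2r). -/

import Mathlib

open Filter Topology
open scoped InnerProductSpace

variable {H : Type*} [NormedAddCommGroup H] [InnerProductSpace ℂ H] [CompleteSpace H]

/-- The numerical radius of a bounded operator `T`:
`ω(T) = sup {|⟨Tx, x⟩| : ‖x‖ = 1}`. -/
noncomputable def nrad (T : H →L[ℂ] H) : ℝ :=
  sSup {r : ℝ | ∃ x : H, ‖x‖ = 1 ∧ r = ‖⟪x, T x⟫_ℂ‖}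

/-- Approximate numerical-radius (Birkhoff) orthogonality:
`T ⊥ε_ω S` iff `ω(T + λS)² ≥ ω(T)² − 2ε ω(T) ω(λS)` for all `λ ∈ ℂ`. -/
def NradOrth (ε : ℝ) (T S : H →L[ℂ] H) : Prop :=
  ∀ μ : ℂ, nrad T ^ 2 - 2 * ε * nrad T * nrad (μ • S) ≤ nrad (T + μ • S) ^ 2

section NumericalRadius

variable {E : Type*} [NormedAddCommGroup E] [InnerProductSpace ℂ E]

theorem norm_inner_le_nrad (T : E →L[ℂ] E) {x : E} (hx : ‖x‖ = 1) :
    ‖⟪x, T x⟫_ℂ‖ ≤ nrad T := by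
  refine le_csSup ⟨‖T‖, ?_⟩ ⟨x, hx, rfl⟩
  rintro r ⟨y, hy, rfl⟩
  calc ‖⟪y, T y⟫_ℂ‖ ≤ ‖y‖ * ‖T y‖ := norm_inner_le_norm y (T y)
    _ ≤ ‖T‖ := by simpa [hy] using T.le_opNorm y

theorem nrad_nonneg (T : E →L[ℂ] E) : 0 ≤ nrad T :=
  Real.sSup_nonneg (by rintro r ⟨x, -, rfl⟩; exact norm_nonneg _)

theorem nrad_le {T : E →L[ℂ] E} {c : ℝ} (hc : 0 ≤ c)
    (h : ∀ x : E, ‖x‖ = 1 → ‖⟪x, T x⟫_ℂ‖ ≤ c) : nrad T ≤ c :=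
  Real.sSup_le (by rintro r ⟨x, hx, rfl⟩; exact h x hx) hc

theorem nrad_add_le (T S : E →L[ℂ] E) : nrad (T + S) ≤ nrad T + nrad S := by
  refine nrad_le (add_nonneg (nrad_nonneg T) (nrad_nonneg S)) fun x hx => ?_
  rw [add_apply, inner_add_right]
  exact (norm_add_le _ _).trans
    (add_le_add (norm_inner_le_nrad T hx) (norm_inner_le_nrad S hx))

theorem nrad_smul_le (c : ℂ) (T : E →L[ℂ] E) : nrad (c • T) ≤ ‖c‖ * nrad T := by
  refine nrad_le (mul_nonneg (norm_nonneg c) (nrad_nonneg T)) fun x hx => ?_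
  rw [smul_apply, inner_smul_right, norm_mul]
  exact mul_le_mul_of_nonneg_left (norm_inner_le_nrad T hx) (norm_nonneg c)

theorem abs_nrad_add_smul_sub_le (T S : E →L[ℂ] E) (c : ℂ) :
    |nrad (T + c • S) - nrad T| ≤ ‖c‖ * nrad S := by
  have h₁ := nrad_add_le T (c • S)
  have h₂ := nrad_add_le (T + c • S) ((-c) • S)
  rw [neg_smul, add_neg_cancel_right, ← neg_smul] at h₂
  have h₃ := nrad_smul_le c S
  have h₄ := nrad_smul_le (-c) S
  rw [norm_neg] at h₄
  rw [abs_le]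
  constructor <;> linarith

end NumericalRadius

/-- The Schwarz-type inequality `|D^θ_ω(T, S)| ≤ ω(T) ω(S)`. -/
theorem nrad_deriv_schwarz (T S : H →L[ℂ] H) (θ : ℝ)
    (hθ : θ ∈ Set.Ico (0 : ℝ) (2 * Real.pi)) (D : ℝ)
    (hD : Tendsto
      (fun r : ℝ =>
        (nrad (T + ((r : ℂ) * Complex.exp ((θ : ℂ) * Complex.I)) • S) ^ 2 - nrad T ^ 2) /
          (2 * r))
      (𝓝[>] (0 : ℝ)) (𝓝 D)) :
    |D| ≤ nrad T * nrad S := by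
  have hbound : Tendsto (fun r : ℝ => nrad S * (nrad T + r * nrad S / 2)) (𝓝[>] (0 : ℝ))
      (𝓝 (nrad T * nrad S)) := by
    have hcont : Continuous fun r : ℝ => nrad S * (nrad T + r * nrad S / 2) := by fun_prop
    have h := hcont.tendsto 0
    simp only [zero_mul, zero_div, add_zero, mul_comm (nrad S) (nrad T)] at h
    exact h.mono_left nhdsWithin_le_nhds
  refine le_of_tendsto_of_tendsto hD.abs hbound ?_
  filter_upwards [self_mem_nhdsWithin] with r (hr : 0 < r)
  have hnorm : ‖(r : ℂ) * Complex.exp ((θ : ℂ) * Complex.I)‖ = r := by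
    rw [norm_mul, Complex.norm_exp_ofReal_mul_I, mul_one, Complex.norm_real, Real.norm_eq_abs,
      abs_of_pos hr]
  have hlip := abs_nrad_add_smul_sub_le T S ((r : ℂ) * Complex.exp ((θ : ℂ) * Complex.I))
  rw [hnorm] at hlip
  set a := nrad (T + ((r : ℂ) * Complex.exp ((θ : ℂ) * Complex.I)) • S)
  have ha : 0 ≤ a := nrad_nonneg _
  have hT := nrad_nonneg T
  have hS := nrad_nonneg S
  have hsum : a + nrad T ≤ 2 * nrad T + r * nrad S := by linarith [(abs_le.mp hlip).2]
  rw [abs_div, abs_of_pos (by positivity : 0 < 2 * r), div_le_iff₀ (by positivity), sq_sub_sq,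
    abs_mul, abs_of_nonneg (add_nonneg ha hT)]
  calc (a + nrad T) * |a - nrad T|
      ≤ (2 * nrad T + r * nrad S) * (r * nrad S) := by gcongr
    _ = nrad S * (nrad T + r * nrad S / 2) * (2 * r) := by ring
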